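/- (Lemma 1: upper bound on the condition number of the Woodbury operator.) Let Ã be an invertible n×n real matrix, L an n×k real matrix with linearly independent columns (equivalently, LᵀL invertible), and R a k×n real matrix with linearly independent rows (equivalently, R·Rᵀ invertible), and assume Â = Ã + L·R is invertible. Then the Woodbury operator W = I_k + R·Ã⁻¹·L is invertible and κ(W) ≤ min{ (‖L†‖·‖L‖)², (‖R†‖·‖R‖)² } · κ(Â) · κ(Ã), where L† = (LᵀL)⁻¹Lᵀ and R† = Rᵀ(R·Rᵀ)⁻¹. -/

import Mathlib

open Matrix

/-- The spectral norm of a real matrix: the operator norm of the induced linear map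
between Euclidean spaces. -/
noncomputable def specNorm {m n : ℕ} (M : Matrix (Fin m) (Fin n) ℝ) : ℝ :=
  ‖LinearMap.toContinuousLinearMap (Matrix.toEuclideanLin M)‖

open scoped Matrix.Norms.L2Operator in
theorem specNorm_mul_le {l m n : ℕ} (A : Matrix (Fin l) (Fin m) ℝ) (B : Matrix (Fin m) (Fin n) ℝ) :
    specNorm (A * B) ≤ specNorm A * specNorm B :=
  Matrix.l2_opNorm_mul A B

theorem specNorm_nonneg {m n : ℕ} (A : Matrix (Fin m) (Fin n) ℝ) : 0 ≤ specNorm A :=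
  norm_nonneg _

theorem specNorm_mul_four_le {l m n p q : ℕ} (A : Matrix (Fin l) (Fin m) ℝ)
    (B : Matrix (Fin m) (Fin n) ℝ) (C : Matrix (Fin n) (Fin p) ℝ) (D : Matrix (Fin p) (Fin q) ℝ) :
    specNorm (A * B * C * D) ≤ specNorm A * specNorm B * specNorm C * specNorm D := by
  grw [specNorm_mul_le, specNorm_mul_le, specNorm_mul_le]
  all_goals exact specNorm_nonneg _

/-- Lemma 1: upper bound on the condition number of the Woodbury
operator: `κ(W) ≤ min{(‖L†‖·‖L‖)², (‖R†‖·‖R‖)²}·κ(Â)·κ(Ã)`. -/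
theorem woodbury_condition_bound {n k : ℕ}
    (Atil : Matrix (Fin n) (Fin n) ℝ)
    (L : Matrix (Fin n) (Fin k) ℝ) (R : Matrix (Fin k) (Fin n) ℝ)
    (hA : IsUnit Atil.det) (hG : IsUnit (Lᵀ * L).det)
    (hR : IsUnit (R * Rᵀ).det)
    (hAhat : IsUnit (Atil + L * R).det) :
    IsUnit (1 + R * Atil⁻¹ * L).det ∧
    specNorm (1 + R * Atil⁻¹ * L) * specNorm (1 + R * Atil⁻¹ * L)⁻¹ ≤
      min ((specNorm ((Lᵀ * L)⁻¹ * Lᵀ) * specNorm L) ^ 2)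
          ((specNorm (Rᵀ * (R * Rᵀ)⁻¹) * specNorm R) ^ 2) *
        (specNorm (Atil + L * R) * specNorm (Atil + L * R)⁻¹) *
        (specNorm Atil * specNorm Atil⁻¹) := by
  set Ahat := Atil + L * R with hAhat_def
  set W := 1 + R * Atil⁻¹ * L with hW_def
  set Ldag := (Lᵀ * L)⁻¹ * Lᵀ with hLdag_def
  set Rdag := Rᵀ * (R * Rᵀ)⁻¹ with hRdag_def
  have hLdag : Ldag * L = 1 := by
    rw [hLdag_def, Matrix.mul_assoc, Matrix.nonsing_inv_mul _ hG]
  have hRdag : R * Rdag = 1 := by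
    rw [hRdag_def, ← Matrix.mul_assoc, Matrix.mul_nonsing_inv _ hR]
  have hLW : L * W = Ahat * Atil⁻¹ * L := by
    simp only [hW_def, hAhat_def, Matrix.mul_add, Matrix.add_mul, Matrix.mul_one,
      Matrix.mul_nonsing_inv _ hA, Matrix.one_mul, Matrix.mul_assoc]
  have hWR : W * R = R * Atil⁻¹ * Ahat := by
    simp only [hW_def, hAhat_def, Matrix.mul_add, Matrix.add_mul, Matrix.mul_one,
      Matrix.nonsing_inv_mul _ hA, Matrix.one_mul, Matrix.mul_assoc]
  have hWL_eq : W = Ldag * Ahat * Atil⁻¹ * L := by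
    rw [Matrix.mul_assoc, Matrix.mul_assoc, ← Matrix.mul_assoc Ahat, ← hLW,
      ← Matrix.mul_assoc, hLdag, Matrix.one_mul]
  have hWR_eq : W = R * Atil⁻¹ * Ahat * Rdag := by
    rw [← hWR, Matrix.mul_assoc, hRdag, Matrix.mul_one]
  have hLinv : Ldag * Atil * Ahat⁻¹ * L * W = 1 := by
    rw [Matrix.mul_assoc, hLW, Matrix.mul_assoc Ahat, Matrix.mul_assoc,
      Matrix.nonsing_inv_mul_cancel_left _ _ hAhat, Matrix.mul_assoc,
      Matrix.mul_nonsing_inv_cancel_left _ _ hA, hLdag]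
  have hRinv : W * (R * Ahat⁻¹ * Atil * Rdag) = 1 := by
    rw [Matrix.mul_assoc, Matrix.mul_assoc, ← Matrix.mul_assoc W, hWR, Matrix.mul_assoc,
      Matrix.mul_nonsing_inv_cancel_left _ _ hAhat, Matrix.mul_assoc,
      Matrix.nonsing_inv_mul_cancel_left _ _ hA, hRdag]
  refine ⟨Matrix.isUnit_det_of_left_inverse hLinv, ?_⟩
  have hbound {a b c d : ℝ} (h₁ : specNorm W ≤ a) (h₂ : specNorm W⁻¹ ≤ b)
      (h : a * b = c * d) : specNorm W * specNorm W⁻¹ ≤ c * d :=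
    h ▸ mul_le_mul h₁ h₂ (specNorm_nonneg _) ((specNorm_nonneg _).trans h₁)
  rw [mul_assoc]
  rcases min_choice ((specNorm Ldag * specNorm L) ^ 2) ((specNorm Rdag * specNorm R) ^ 2)
    with h | h <;> rw [h]
  · refine hbound (hWL_eq ▸ specNorm_mul_four_le Ldag Ahat Atil⁻¹ L)
      (Matrix.inv_eq_left_inv hLinv ▸ specNorm_mul_four_le Ldag Atil Ahat⁻¹ L) ?_
    ring
  · refine hbound (hWR_eq ▸ specNorm_mul_four_le R Atil⁻¹ Ahat Rdag)
      (Matrix.inv_eq_right_inv hRinv ▸ specNorm_mul_four_le R Ahat⁻¹ Atil Rdag) ?_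
    ring
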